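/- Suppose u = Ψc* + z with ‖z‖₂ ≤ ε, where c* is S-sparse with S > 1, and suppose the S-restricted isometry constant of Ψ satisfies δ_S < 0.307. Then any minimizer c̄ of ‖c‖₁ subject to ‖u − Ψc‖₂ ≤ ε satisfies ‖c* − c̄‖₂ ≤ ε/(0.307 − δ_S). -/

import Mathlib

open Finset

noncomputable def coherence {M K : ℕ} (Ψ : Matrix (Fin M) (Fin K) ℝ) : ℝ :=
  sSup {x : ℝ | ∃ i j : Fin K, i ≠ j ∧
    x = |∑ m, Ψ m i * Ψ m j| /
      (Real.sqrt (∑ m, (Ψ m i)^2) * Real.sqrt (∑ m, (Ψ m j)^2))}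

noncomputable def l0 {K : ℕ} (c : Fin K → ℝ) : ℕ := (Finset.univ.filter fun j => c j ≠ 0).card

noncomputable def l1 {K : ℕ} (c : Fin K → ℝ) : ℝ := ∑ j, |c j|

noncomputable def l2 {n : ℕ} (c : Fin n → ℝ) : ℝ := Real.sqrt (∑ j, (c j)^2)

noncomputable def ripConst {M K : ℕ} (Ψ : Matrix (Fin M) (Fin K) ℝ) (S : ℕ) : ℝ :=
  sInf {δ : ℝ | 0 ≤ δ ∧ ∀ c : Fin K → ℝ, l0 c ≤ S →
    (1 - δ) * (l2 c)^2 ≤ (l2 (Ψ.mulVec c))^2 ∧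
    (l2 (Ψ.mulVec c))^2 ≤ (1 + δ) * (l2 c)^2}

lemma l2_nonneg' {n : ℕ} (c : Fin n → ℝ) : 0 ≤ l2 c := Real.sqrt_nonneg _

lemma l2_sq' {n : ℕ} (c : Fin n → ℝ) : (l2 c)^2 = dotProduct c c := by
  unfold l2
  rw [Real.sq_sqrt (Finset.sum_nonneg fun _ _ => sq_nonneg _)]
  simp [dotProduct, sq]

lemma cs_dot {n : ℕ} (a b : Fin n → ℝ) : dotProduct a b ≤ l2 a * l2 b := by
  have h := Finset.sum_mul_sq_le_sq_mul_sq Finset.univ a b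
  apply le_of_sq_le_sq _ (mul_nonneg (l2_nonneg' a) (l2_nonneg' b))
  rw [mul_pow, l2_sq', l2_sq']
  simpa [dotProduct, sq] using h
where
  le_of_sq_le_sq {x y : ℝ} (h : x^2 ≤ y^2) (hy : 0 ≤ y) : x ≤ y := by nlinarith [abs_le_of_sq_le_sq' h hy]

lemma l2_zero_of {n : ℕ} (c : Fin n → ℝ) (h : l2 c = 0) : c = 0 := by
  have := l2_sq' c
  rw [h] at this
  exact dotProduct_self_eq_zero.1 (by linarith)

lemma l2_add_le {n : ℕ} (a b : Fin n → ℝ) : l2 (a + b) ≤ l2 a + l2 b := by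
  have h1 := cs_dot a b
  have h2 := l2_sq' (a + b)
  have ha := l2_nonneg' a
  have hb := l2_nonneg' b
  have hc : dotProduct b a = dotProduct a b := dotProduct_comm _ _
  simp only [add_dotProduct, dotProduct_add] at h2
  rw [← l2_sq', ← l2_sq', hc] at h2
  apply (abs_le_of_sq_le_sq' _ (by positivity)).2
  nlinarith

/-- RIP with constant `d` and order `k`. -/
def IsRip {M K : ℕ} (Ψ : Matrix (Fin M) (Fin K) ℝ) (k : ℕ) (δ : ℝ) : Prop :=
  0 ≤ δ ∧ ∀ c : Fin K → ℝ, l0 c ≤ k →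
    (1 - δ) * (l2 c)^2 ≤ (l2 (Ψ.mulVec c))^2 ∧
    (l2 (Ψ.mulVec c))^2 ≤ (1 + δ) * (l2 c)^2

lemma ripConst_isRip {M K : ℕ} (Ψ : Matrix (Fin M) (Fin K) ℝ) (S : ℕ) :
    IsRip Ψ S (ripConst Ψ S) := by
  have hne : {δ : ℝ | IsRip Ψ S δ}.Nonempty := by
    have hC : 0 ≤ ∑ m, ∑ j, (Ψ m j)^2 := by positivity
    refine ⟨1 + ∑ m, ∑ j, (Ψ m j)^2, by positivity, fun c _ => ⟨?_, ?_⟩⟩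
    · nlinarith [sq_nonneg (l2 c), sq_nonneg (l2 (Ψ.mulVec c))]
    · have : (l2 (Ψ.mulVec c))^2 ≤ (∑ m, ∑ j, (Ψ m j)^2) * (l2 c)^2 := by
        rw [l2_sq', l2_sq', Finset.sum_mul]
        unfold dotProduct
        apply Finset.sum_le_sum
        intro i _
        have h := Finset.sum_mul_sq_le_sq_mul_sq Finset.univ (Ψ i) c
        simpa [Matrix.mulVec, dotProduct, sq] using h
      nlinarith [sq_nonneg (l2 c)]
  have hcl : IsClosed {δ : ℝ | IsRip Ψ S δ} := by
    unfold IsRip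
    simp only [Set.setOf_and, Set.setOf_forall]
    apply isClosed_Ici.inter
    refine isClosed_iInter fun c => isClosed_iInter fun _ => ?_
    apply IsClosed.inter
    · exact isClosed_le (by fun_prop) (by fun_prop)
    · exact isClosed_le (by fun_prop) (by fun_prop)
  have := hcl.csInf_mem hne ⟨0, fun _ h => h.1⟩
  exact this

lemma l0_le {K : ℕ} (c : Fin K → ℝ) (A : Finset (Fin K)) (h : ∀ j, j ∉ A → c j = 0) :
    l0 c ≤ A.card := by
  apply Finset.card_le_card
  intro j hj
  by_contra hA
  simp [h j hA] at hj

lemma theta_one {M K : ℕ} (Ψ : Matrix (Fin M) (Fin K) ℝ) (k : ℕ) (δ : ℝ) (hR : IsRip Ψ k δ)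
    (x y : Fin K → ℝ) (A B : Finset (Fin K)) (hAB : Disjoint A B) (hc : A.card + B.card ≤ k)
    (hx : ∀ j, j ∉ A → x j = 0) (hy : ∀ j, j ∉ B → y j = 0) :
    dotProduct (Ψ.mulVec x) (Ψ.mulVec y) ≤ δ * l2 x * l2 y := by
  rcases (l2_nonneg' x).eq_or_lt with h0 | hxp
  · have := l2_zero_of x h0.symm
    subst this
    simp [← h0]
  rcases (l2_nonneg' y).eq_or_lt with h0 | hyp
  · have := l2_zero_of y h0.symm
    subst this
    simp [← h0]
  have hxy : dotProduct x y = 0 := by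
    apply Finset.sum_eq_zero
    intro j _
    by_cases hj : j ∈ A
    · rw [hy j (Finset.disjoint_left.1 hAB hj), mul_zero]
    · rw [hx j hj, zero_mul]
  have hyx : dotProduct y x = 0 := by rw [dotProduct_comm, hxy]
  set a := l2 x with ha
  set b := l2 y with hb
  have key : ∀ t : ℝ, l0 (b • x + t • y) ≤ k := by
    intro t
    refine (l0_le _ (A ∪ B) ?_).trans ((Finset.card_union_le _ _).trans hc)
    intro j hj
    simp only [Finset.mem_union, not_or] at hj
    simp [hx j hj.1, hy j hj.2]
  have h1 := (hR.2 _ (key a)).2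
  have h2 := (hR.2 _ (key (-a))).1
  have hcm : dotProduct (Ψ.mulVec y) (Ψ.mulVec x) = dotProduct (Ψ.mulVec x) (Ψ.mulVec y) :=
    dotProduct_comm _ _
  simp only [l2_sq', Matrix.mulVec_add, Matrix.mulVec_smul, add_dotProduct, dotProduct_add,
    smul_dotProduct, dotProduct_smul, smul_eq_mul, hxy, hyx, hcm] at h1 h2
  have hxx : dotProduct x x = a^2 := (l2_sq' x).symm
  have hyy : dotProduct y y = b^2 := (l2_sq' y).symm
  rw [hxx, hyy] at h1 h2
  have hp : 0 < a * b := mul_pos hxp hyp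
  have : (a * b) * dotProduct (Ψ.mulVec x) (Ψ.mulVec y) ≤ (a * b) * (δ * a * b) := by
    nlinarith
  exact le_of_mul_le_mul_left this hp

/-- restriction -/
def restr {K : ℕ} (A : Finset (Fin K)) (x : Fin K → ℝ) : Fin K → ℝ := fun j => if j ∈ A then x j else 0

lemma restr_split {K : ℕ} (A : Finset (Fin K)) (x : Fin K → ℝ) : restr A x + restr Aᶜ x = x := by
  ext j
  by_cases h : j ∈ A <;> simp [restr, h]

lemma restr_sq {K : ℕ} (A : Finset (Fin K)) (x : Fin K → ℝ) :
    (l2 x)^2 = (l2 (restr A x))^2 + (l2 (restr Aᶜ x))^2 := by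
  simp only [l2_sq', dotProduct, ← Finset.sum_add_distrib]
  apply Finset.sum_congr rfl
  intro j _
  by_cases h : j ∈ A <;> simp [restr, h]

lemma theta_lift {M K : ℕ} (Ψ : Matrix (Fin M) (Fin K) ℝ) (k n : ℕ) (δ : ℝ) (hR : IsRip Ψ k δ)
    (y : Fin K → ℝ) (B : Finset (Fin K)) (hc : n + B.card ≤ k)
    (hy : ∀ j, j ∉ B → y j = 0) (p : ℕ) :
    ∀ (x : Fin K → ℝ) (A : Finset (Fin K)), Disjoint A B → A.card ≤ p * n →
    (∀ j, j ∉ A → x j = 0) →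
    dotProduct (Ψ.mulVec x) (Ψ.mulVec y) ≤ δ * (√p * l2 x) * l2 y := by
  induction p with
  | zero =>
    intro x A _ hA hx
    have : x = 0 := by
      ext j
      apply hx
      have : A = ∅ := by simpa using hA
      simp [this]
    subst this
    simp
  | succ p ih =>
    intro x A hAB hA hx
    obtain ⟨A1, hA1, hcard⟩ := Finset.exists_subset_card_eq (Nat.min_le_left A.card n)
    have hd : (A \ A1).card ≤ p * n := by
      rw [Finset.card_sdiff_of_subset hA1, hcard]
      rw [add_mul, one_mul] at hA
      omega
    have t1 := theta_one Ψ k δ hR (restr A1 x) y A1 B (hAB.mono_left hA1)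
      (by omega) (fun j hj => by simp [restr, hj]) hy
    have t2 := ih (restr A1ᶜ x) (A \ A1) (hAB.mono_left Finset.sdiff_subset) hd (by
      intro j hj
      by_cases h : j ∈ A1
      · simp [restr, h]
      · have : j ∉ A := fun h' => hj (by simp [h, h'])
        simp [restr, hx j this])
    have hsq := restr_sq A1 x
    have e : dotProduct (Ψ.mulVec x) (Ψ.mulVec y) = dotProduct (Ψ.mulVec (restr A1 x)) (Ψ.mulVec y)
        + dotProduct (Ψ.mulVec (restr A1ᶜ x)) (Ψ.mulVec y) := by
      rw [← add_dotProduct, ← Matrix.mulVec_add, restr_split]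
    have hle : l2 (restr A1 x) + √p * l2 (restr A1ᶜ x) ≤ √(p+1:ℕ) * l2 x := by
      apply (abs_le_of_sq_le_sq' _ (mul_nonneg (Real.sqrt_nonneg _) (l2_nonneg' _))).2
      rw [mul_pow, Real.sq_sqrt (by positivity), hsq]
      have hp : (√(p:ℝ))^2 = p := Real.sq_sqrt (by positivity)
      push_cast
      nlinarith [sq_nonneg (√(p:ℝ) * l2 (restr A1 x) - l2 (restr A1ᶜ x))]
    rw [e]
    have := mul_le_mul_of_nonneg_left hle (mul_nonneg hR.1 (l2_nonneg' y))
    nlinarith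

lemma top_exists {K : ℕ} (U : Finset (Fin K)) (w : Fin K → ℝ) (hw : ∀ j, 0 ≤ w j) (m : ℕ) :
    ∃ (A : Finset (Fin K)) (τ : ℝ), A ⊆ U ∧ A.card ≤ m ∧ 0 ≤ τ ∧ (∀ a ∈ A, τ ≤ w a) ∧
      (∀ b ∈ U \ A, w b ≤ τ) ∧ (A.card = m ∨ τ = 0) := by
  induction m with
  | zero =>
    refine ⟨∅, ∑ j, w j, by simp, by simp, Finset.sum_nonneg fun j _ => hw j, by simp, ?_, by simp⟩
    intro b _
    exact Finset.single_le_sum (fun j _ => hw j) (Finset.mem_univ b)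
  | succ m ih =>
    obtain ⟨A, τ, hAU, hAm, hτ, h1, h2, h3⟩ := ih
    rcases (U \ A).eq_empty_or_nonempty with he | hn
    · exact ⟨A, 0, hAU, by omega, le_rfl, fun a _ => hw a, by simp [he], Or.inr rfl⟩
    · obtain ⟨a, ha, hmax⟩ := Finset.exists_max_image (U \ A) w hn
      have ha' := Finset.mem_sdiff.1 ha
      refine ⟨insert a A, w a, ?_, ?_, hw a, ?_, ?_, ?_⟩
      · exact Finset.insert_subset ha'.1 hAU
      · rw [Finset.card_insert_of_notMem ha'.2]; omega
      · intro b hb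
        rcases Finset.mem_insert.1 hb with rfl | hb
        · exact le_rfl
        · exact (h2 a ha).trans (h1 b hb)
      · intro b hb
        apply hmax
        simp only [Finset.mem_sdiff, Finset.mem_insert, not_or] at hb ⊢
        exact ⟨hb.1, hb.2.2⟩
      · rcases h3 with h3 | h3
        · left; rw [Finset.card_insert_of_notMem ha'.2, h3]
        · right; exact le_antisymm (h3 ▸ h2 a ha) (hw a)

lemma lp_bound {K : ℕ} (U A : Finset (Fin K)) (w v : Fin K → ℝ) (m : ℕ) (τ α : ℝ)
    (hAU : A ⊆ U) (hτ : 0 ≤ τ) (h1 : ∀ a ∈ A, τ ≤ w a)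
    (h2 : ∀ b ∈ U \ A, w b ≤ τ) (h3 : A.card = m ∨ τ = 0)
    (hv : ∀ j ∈ U, 0 ≤ v j) (hvα : ∀ j ∈ U, v j ≤ α) (hs : ∑ j ∈ U, v j ≤ m * α) :
    ∑ j ∈ U, w j * v j ≤ α * ∑ j ∈ A, w j := by
  rw [← Finset.sum_sdiff hAU] at hs ⊢
  have e1 : ∑ j ∈ U \ A, w j * v j ≤ τ * ∑ j ∈ U \ A, v j := by
    rw [Finset.mul_sum]
    exact Finset.sum_le_sum fun j hj =>
      mul_le_mul_of_nonneg_right (h2 j hj) (hv j (Finset.mem_sdiff.1 hj).1)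
  have e2 : ∑ j ∈ A, w j * v j ≤ ∑ j ∈ A, (α * w j - τ * (α - v j)) := by
    apply Finset.sum_le_sum
    intro j hj
    nlinarith [h1 j hj, hvα j (hAU hj)]
  rw [Finset.sum_sub_distrib, ← Finset.mul_sum, ← Finset.mul_sum, Finset.sum_sub_distrib,
    Finset.sum_const, nsmul_eq_mul] at e2
  rcases h3 with h3 | h3
  · rw [h3] at e2
    nlinarith
  · subst h3
    linarith

lemma theta_l1 {M K : ℕ} (Ψ : Matrix (Fin M) (Fin K) ℝ) (k n m p : ℕ) (δ α : ℝ)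
    (hR : IsRip Ψ k δ) (hnm : n + m ≤ k) (x v : Fin K → ℝ) (T : Finset (Fin K))
    (hT : T.card ≤ p * n) (hx : ∀ j, j ∉ T → x j = 0) (hv0 : ∀ j ∈ T, v j = 0)
    (hα : 0 ≤ α) (hvα : ∀ j, |v j| ≤ α) (hs : ∑ j, |v j| ≤ m * α) :
    -(dotProduct (Ψ.mulVec x) (Ψ.mulVec v)) ≤ δ * (√p * l2 x) * (√m * α) := by
  set g : Fin K → ℝ := Matrix.vecMul (Ψ.mulVec x) Ψ with hg
  have hdot : ∀ y, dotProduct (Ψ.mulVec x) (Ψ.mulVec y) = ∑ j, g j * y j := fun y => by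
    rw [Matrix.dotProduct_mulVec]; rfl
  obtain ⟨A, τ, hAU, hAm, hτ, h1, h2, h3⟩ := top_exists Tᶜ (fun j => |g j|) (fun _ => abs_nonneg _) m
  have hsU : ∑ j ∈ Tᶜ, |v j| ≤ m * α :=
    (Finset.sum_le_univ_sum_of_nonneg fun j => abs_nonneg (v j)).trans hs
  have hlp := lp_bound Tᶜ A (fun j => |g j|) (fun j => |v j|) m τ α hAU hτ h1 h2 h3
    (fun _ _ => abs_nonneg _) (fun j _ => hvα j) hsU
  have hle : -(dotProduct (Ψ.mulVec x) (Ψ.mulVec v)) ≤ ∑ j ∈ Tᶜ, |g j| * |v j| := by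
    rw [hdot, ← Finset.sum_neg_distrib, ← Finset.sum_add_sum_compl T]
    rw [Finset.sum_eq_zero (s := T) (fun j hj => by simp [hv0 j hj]), zero_add]
    apply Finset.sum_le_sum
    intro j _
    rw [← abs_mul]
    exact neg_le_abs _
  set y : Fin K → ℝ := fun j => if j ∈ A then (if 0 ≤ g j then α else -α) else 0 with hy
  have hly : l2 y ≤ √m * α := by
    apply (abs_le_of_sq_le_sq' _ (by positivity)).2
    rw [l2_sq', mul_pow, Real.sq_sqrt (by positivity)]
    have : dotProduct y y = ∑ j ∈ A, α^2 := by
      unfold dotProduct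
      rw [← Finset.sum_add_sum_compl A,
        Finset.sum_eq_zero (s := Aᶜ) (fun j hj => by simp [hy, Finset.mem_compl.1 hj]), add_zero]
      apply Finset.sum_congr rfl
      intro j hj
      by_cases h : 0 ≤ g j <;> simp [hy, hj, h, sq]
    rw [this, Finset.sum_const, nsmul_eq_mul]
    have : (A.card : ℝ) ≤ m := by exact_mod_cast hAm
    nlinarith [sq_nonneg α]
  have hyA : dotProduct (Ψ.mulVec x) (Ψ.mulVec y) = α * ∑ j ∈ A, |g j| := by
    rw [hdot, ← Finset.sum_add_sum_compl A,
        Finset.sum_eq_zero (s := Aᶜ) (fun j hj => by simp [hy, Finset.mem_compl.1 hj]), add_zero,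
        Finset.mul_sum]
    apply Finset.sum_congr rfl
    intro j hj
    by_cases h : 0 ≤ g j
    · simp [hy, hj, h, abs_of_nonneg h, mul_comm]
    · simp [hy, hj, h, abs_of_neg (not_le.1 h), mul_comm]
  have ht := theta_lift Ψ k n δ hR y A (by omega) (fun j hj => by simp [hy, hj]) p x T
    (by
      rw [Finset.disjoint_left]
      intro j hj hj'
      exact Finset.mem_compl.1 (hAU hj') hj) hT hx
  have := mul_le_mul_of_nonneg_left hly
    (mul_nonneg hR.1 (mul_nonneg (Real.sqrt_nonneg p) (l2_nonneg' x)))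
  linarith

lemma params (k : ℕ) (hk : 1 < k) : ∃ n m p : ℕ, n + m ≤ k ∧ 0 < m ∧ k ≤ p * n ∧ p * k ≤ 5 * m := by
  by_cases h3 : k = 3
  · exact ⟨1, 2, 3, by omega, by omega, by omega, by omega⟩
  · exact ⟨k - k / 2, k / 2, 2, by omega, by omega, by omega, by omega⟩

lemma final_arith (δ X H ε P : ℝ) (hδ0 : 0 ≤ δ) (hδ : δ < 0.307) (hX : 0 ≤ X) (hH : 0 ≤ H)
    (hε : 0 ≤ ε) (hP : 0 ≤ P) (hPu : P^2 ≤ (1 + δ) * X^2) (hPl : (1 - δ) * X^2 ≤ P^2)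
    (hmain : P^2 ≤ P * (2 * ε) + 2.24 * δ * X^2) (hHX : H^2 ≤ 2 * X^2) :
    H * (0.307 - δ) ≤ ε := by
  have hPH : 2 * (P * H) ≤ 3.24 * X^2 := by
    apply (abs_le_of_sq_le_sq' _ (by positivity)).2
    have h1 : P^2 * H^2 ≤ ((1 + δ) * X^2) * (2 * X^2) :=
      mul_le_mul hPu hHX (sq_nonneg _) (by positivity)
    have h2 : 0 ≤ X^2 * X^2 := by positivity
    nlinarith
  have h4 : 3.24 * (0.307 - δ) * X^2 ≤ P * (2 * ε) := by nlinarith [sq_nonneg X]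
  rcases hX.eq_or_lt with h0 | hXp
  · subst h0
    have : H = 0 := by nlinarith
    subst this
    simpa using hε
  · have hX2 : 0 < 3.24 * X^2 := by positivity
    have hd : 0 < 0.307 - δ := by linarith
    have a1 : H * (0.307 - δ) * (3.24 * X^2) ≤ H * (P * (2 * ε)) := by nlinarith
    have a2 : H * (P * (2 * ε)) ≤ ε * (3.24 * X^2) := by nlinarith
    exact le_of_mul_le_mul_right (a1.trans a2) hX2

lemma core {M K : ℕ} (Ψ : Matrix (Fin M) (Fin K) ℝ) (k : ℕ) (hk : 1 < k) (δ ε : ℝ)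
    (hR : IsRip Ψ k δ) (hδ : δ < 0.307) (h : Fin K → ℝ) (hε : 0 ≤ ε)
    (hΨ : l2 (Ψ.mulVec h) ≤ 2 * ε) (T : Finset (Fin K)) (hT : T.card ≤ k)
    (hcone : ∑ j ∈ Tᶜ, |h j| ≤ ∑ j ∈ T, |h j|) :
    l2 h * (0.307 - δ) ≤ ε := by
  obtain ⟨A, τ, -, hAm, hτ, h1, h2, h3⟩ := top_exists Finset.univ (fun j => |h j|)
    (fun _ => abs_nonneg _) k
  have hTA : ∑ j ∈ T, |h j| ≤ ∑ j ∈ A, |h j| := by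
    have := lp_bound Finset.univ A (fun j => |h j|) (fun j => if j ∈ T then 1 else 0) k τ 1
      (Finset.subset_univ _) hτ h1 h2 h3 (fun j _ => by split_ifs <;> norm_num)
      (fun j _ => by split_ifs <;> norm_num) (by simpa using hT)
    simpa using this
  have hconeA : ∑ j ∈ Aᶜ, |h j| ≤ ∑ j ∈ A, |h j| := by
    have e1 := Finset.sum_add_sum_compl T (fun j => |h j|)
    have e2 := Finset.sum_add_sum_compl A (fun j => |h j|)
    linarith
  set L := ∑ j ∈ A, |h j| with hL
  have hL0 : 0 ≤ L := Finset.sum_nonneg fun _ _ => abs_nonneg _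
  have hτL : k * τ ≤ L := by
    rcases h3 with h3 | h3
    · rw [← h3, ← nsmul_eq_mul]
      exact Finset.card_nsmul_le_sum _ _ _ h1
    · rw [h3, mul_zero]; exact hL0
  set x := restr A h with hx
  set v := restr Aᶜ h with hv
  have hLX : L^2 ≤ k * (l2 x)^2 := by
    have e : (l2 x)^2 = ∑ j ∈ A, |h j|^2 := by
      rw [l2_sq', dotProduct, ← Finset.sum_add_sum_compl A, Finset.sum_eq_zero (s := Aᶜ)
        (fun j hj => by simp [hx, restr, Finset.mem_compl.1 hj]), add_zero]
      exact Finset.sum_congr rfl fun j hj => by simp [hx, restr, hj, sq]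
    rw [e]
    have := sq_sum_le_card_mul_sum_sq (s := A) (f := fun j => |h j|)
    refine this.trans ?_
    have hAk : (A.card : ℝ) ≤ k := by exact_mod_cast hAm
    exact mul_le_mul_of_nonneg_right hAk (by positivity)
  have hvτ : ∀ j, |v j| ≤ τ := by
    intro j
    by_cases hj : j ∈ A
    · simpa [hv, restr, hj] using hτ
    · simpa [hv, restr, hj] using h2 j (by simp [hj])
  have hvs : ∑ j, |v j| ≤ L := by
    rw [← Finset.sum_add_sum_compl A, Finset.sum_eq_zero (s := A)
        (fun j hj => by simp [hv, restr, hj]), zero_add]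
    refine le_trans (Finset.sum_le_sum fun j hj => ?_) hconeA
    simp [hv, restr, Finset.mem_compl.1 hj]
  have hk0 : (0:ℝ) < k := by positivity
  have hvX : (l2 v)^2 ≤ (l2 x)^2 := by
    have e : (l2 v)^2 ≤ τ * ∑ j, |v j| := by
      rw [l2_sq', dotProduct, Finset.mul_sum]
      apply Finset.sum_le_sum
      intro j _
      rw [← abs_mul_abs_self]
      exact mul_le_mul_of_nonneg_right (hvτ j) (abs_nonneg _)
    have e2 : τ * ∑ j, |v j| ≤ τ * L := mul_le_mul_of_nonneg_left hvs hτ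
    have e3 : k * (τ * L) ≤ k * (l2 x)^2 := by nlinarith
    exact e.trans (e2.trans (le_of_mul_le_mul_left e3 hk0))
  obtain ⟨n, m, p, hnm, hm, hkp, hpk⟩ := params k hk
  have hm0 : (0:ℝ) < m := by positivity
  have hmk : (m:ℝ) ≤ k := by exact_mod_cast (by omega : m ≤ k)
  have hth := theta_l1 Ψ k n m p δ (L / m) hR hnm x v A (hAm.trans hkp)
    (fun j hj => by simp [hx, restr, hj]) (fun j hj => by simp [hv, restr, hj]) (by positivity)
    (fun j => (hvτ j).trans (by rw [le_div_iff₀ hm0]; nlinarith))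
    (by rw [mul_div_cancel₀ _ hm0.ne']; exact hvs)
  have hX0 := l2_nonneg' x
  have hfac : √p * (√m * (L / m)) ≤ 2.24 * l2 x := by
    apply (abs_le_of_sq_le_sq' _ (by positivity)).2
    have : (√p * (√m * (L / m)))^2 = p * L^2 / m := by
      rw [mul_pow, mul_pow, Real.sq_sqrt (by positivity), Real.sq_sqrt (by positivity)]
      field_simp
    rw [this, div_le_iff₀ hm0]
    have hpk' : (p:ℝ) * k ≤ 5 * m := by exact_mod_cast hpk
    have b1 : (p:ℝ) * L^2 ≤ p * (k * (l2 x)^2) := mul_le_mul_of_nonneg_left hLX (by positivity)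
    have b2 : (p:ℝ) * k * (l2 x)^2 ≤ 5 * m * (l2 x)^2 := mul_le_mul_of_nonneg_right hpk' (by positivity)
    have b3 : 0 ≤ m * (l2 x)^2 := by positivity
    nlinarith
  have hr := hR.2 x ((l0_le x A (fun j hj => by simp [hx, restr, hj])).trans hAm)
  have hsplit : dotProduct (Ψ.mulVec x) (Ψ.mulVec h) =
      (l2 (Ψ.mulVec x))^2 + dotProduct (Ψ.mulVec x) (Ψ.mulVec v) := by
    rw [l2_sq', ← dotProduct_add, ← Matrix.mulVec_add, restr_split]
  have hcs := cs_dot (Ψ.mulVec x) (Ψ.mulVec h)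
  have hcs2 := mul_le_mul_of_nonneg_left hΨ (l2_nonneg' (Ψ.mulVec x))
  have hfac2 := mul_le_mul_of_nonneg_left hfac (mul_nonneg hR.1 hX0)
  refine final_arith δ (l2 x) (l2 h) ε (l2 (Ψ.mulVec x)) hR.1 hδ hX0 (l2_nonneg' _) hε
    (l2_nonneg' _) hr.2 hr.1 ?_ ?_
  · nlinarith
  · have := restr_sq A h
    linarith

theorem l1_rip_recovery {M K : ℕ} (Ψ : Matrix (Fin M) (Fin K) ℝ)
    (S : ℕ) (hS : 1 < S)
    (u z : Fin M → ℝ) (cstar : Fin K → ℝ)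
    (hsparse : l0 cstar ≤ S)
    (hu : u = Ψ.mulVec cstar + z) (ε : ℝ) (hz : l2 z ≤ ε)
    (hδ : ripConst Ψ S < 0.307)
    (cbar : Fin K → ℝ)
    (hfeas : l2 (u - Ψ.mulVec cbar) ≤ ε)
    (hmin : ∀ c : Fin K → ℝ, l2 (u - Ψ.mulVec c) ≤ ε → l1 cbar ≤ l1 c) :
    l2 (cstar - cbar) ≤ ε / (0.307 - ripConst Ψ S) := by
  rw [le_div_iff₀ (by linarith)]
  have hl1 : l1 cbar ≤ l1 cstar := hmin cstar (by rw [hu]; simpa using hz)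
  refine core Ψ S hS _ ε (ripConst_isRip Ψ S) hδ (cstar - cbar) ((l2_nonneg' z).trans hz) ?_
    (Finset.univ.filter fun j => cstar j ≠ 0) hsparse ?_
  · have e : Ψ.mulVec (cstar - cbar) = (u - Ψ.mulVec cbar) + (-z) := by
      rw [hu, Matrix.mulVec_sub]; abel
    have hneg : l2 (-z) = l2 z := by simp [l2]
    rw [e]
    refine (l2_add_le _ _).trans ?_
    rw [hneg]; linarith
  · set T := Finset.univ.filter fun j => cstar j ≠ 0 with hT
    unfold l1 at hl1
    rw [← Finset.sum_add_sum_compl T, ← Finset.sum_add_sum_compl T (fun j => |cstar j|)] at hl1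
    have z0 : ∀ j ∈ Tᶜ, cstar j = 0 := fun j hj => by simpa [hT] using hj
    rw [Finset.sum_eq_zero (s := Tᶜ) (f := fun j => |cstar j|) (fun j hj => by simp [z0 j hj]),
      add_zero] at hl1
    have e1 : ∑ j ∈ Tᶜ, |(cstar - cbar) j| = ∑ j ∈ Tᶜ, |cbar j| :=
      Finset.sum_congr rfl fun j hj => by simp [z0 j hj]
    have e2 : ∑ j ∈ T, |cstar j| ≤ ∑ j ∈ T, |(cstar - cbar) j| + ∑ j ∈ T, |cbar j| := by
      rw [← Finset.sum_add_distrib]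
      apply Finset.sum_le_sum
      intro j _
      have := abs_add_le (cstar j - cbar j) (cbar j)
      simpa using this
    rw [e1]; linarith
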